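/- arXiv:2405.16618 — 3 statements merged into one kernel-verified Lean document; each statement's English description precedes it below -/
import Mathlib

section
/- Let ι be a nonempty finite index type and for each e : ι let a e ≠ b e be points of the Euclidean plane; let S = ⋃ e, segment ℝ (a e) (b e) be the corresponding polygonal boundary (a finite union of closed segments). Fix a point c, and for each e let h e be the orthogonal projection of c onto affineSpan ℝ {a e, b e}; call h e an active foot point if h e ∈ segment ℝ (a e) (b e). Then Set.infDist c S equals the minimum of dist c v as v ranges over the finite set consisting of all endpoints a e, b e together with all active foot points h e. (This is the geometric fact underlying the paper's penalty terms O_{i0} and O_{ik}, which compute distances to polygonal boundaries via the vertex set V and the active foot point set H.) -/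
section

variable {V P : Type*} [NormedAddCommGroup V] [InnerProductSpace ℝ V] [MetricSpace P]
  [NormedAddTorsor V P]

/-- If `p` and `x` lie in an affine subspace and `p` is the projection of `c` onto it, then
distances to `c` are ordered like distances to `p`. -/
theorem dist_le_dist_of_dist_orthogonalProjection_le {s : AffineSubspace ℝ P} [Nonempty s]
    [s.direction.HasOrthogonalProjection] (c : P) {x y : P} (hx : x ∈ s) (hy : y ∈ s)
    (hxy : dist y (EuclideanGeometry.orthogonalProjection s c : P) ≤
      dist x (EuclideanGeometry.orthogonalProjection s c : P)) :
    dist c y ≤ dist c x := by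
  have hx' :=
    EuclideanGeometry.dist_sq_eq_dist_orthogonalProjection_sq_add_dist_orthogonalProjection_sq c hx
  have hy' :=
    EuclideanGeometry.dist_sq_eq_dist_orthogonalProjection_sq_add_dist_orthogonalProjection_sq c hy
  rw [dist_comm c y, dist_comm c x]
  refine abs_le_of_sq_le_sq' ?_ dist_nonneg |>.2
  nlinarith [dist_nonneg (x := y) (y := (EuclideanGeometry.orthogonalProjection s c : P))]

end

section

variable {E : Type*} [NormedAddCommGroup E] [InnerProductSpace ℝ E]

/-- A point of a line outside a segment of that line is at least as close to one of the endpoints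
as to any given point of the segment. -/
theorem dist_left_le_or_dist_right_le_of_notMem_segment {a b p x : E}
    (hp : p ∈ affineSpan ℝ {a, b}) (hps : p ∉ segment ℝ a b) (hx : x ∈ segment ℝ a b) :
    dist a p ≤ dist x p ∨ dist b p ≤ dist x p := by
  rw [segment_eq_image_lineMap] at hps hx
  obtain ⟨t, rfl⟩ := mem_affineSpan_pair_iff_exists_lineMap_eq.1 hp
  obtain ⟨s, ⟨hs0, hs1⟩, rfl⟩ := hx
  have ht : t < 0 ∨ 1 < t := by
    by_contra! ht
    exact hps ⟨t, ht, rfl⟩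
  rw [dist_lineMap_lineMap, dist_left_lineMap, dist_right_lineMap, Real.dist_eq, Real.norm_eq_abs,
    Real.norm_eq_abs]
  rcases ht with ht | ht
  · left
    gcongr ?_ * _
    rw [abs_of_neg ht, abs_of_pos] <;> linarith
  · right
    gcongr ?_ * _
    rw [abs_of_neg (by linarith), abs_of_nonpos] <;> linarith

/-- Each point of a segment is at least as far from `c` as one of the endpoints or the foot of the
perpendicular from `c`, the latter only if it lies on the segment. -/
theorem dist_vertex_or_active_foot_le {a b x : E} (c : E) (hx : x ∈ segment ℝ a b) :
    dist c a ≤ dist c x ∨ dist c b ≤ dist c x ∨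
      ((EuclideanGeometry.orthogonalProjection (affineSpan ℝ {a, b}) c : E) ∈ segment ℝ a b ∧
        dist c (EuclideanGeometry.orthogonalProjection (affineSpan ℝ {a, b}) c : E) ≤
          dist c x) := by
  have hp := EuclideanGeometry.orthogonalProjection_mem (s := affineSpan ℝ {a, b}) c
  have ha := left_mem_affineSpan_pair ℝ a b
  have hb := right_mem_affineSpan_pair ℝ a b
  have hxs : x ∈ affineSpan ℝ {a, b} := by
    rw [segment_eq_image_lineMap] at hx
    obtain ⟨s, -, rfl⟩ := hx
    exact AffineMap.lineMap_mem_affineSpan_pair s a b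
  by_cases hps : (EuclideanGeometry.orthogonalProjection (affineSpan ℝ {a, b}) c : E) ∈
      segment ℝ a b
  · refine .inr (.inr ⟨hps, dist_le_dist_of_dist_orthogonalProjection_le c hxs hp ?_⟩)
    rw [dist_self]
    exact dist_nonneg
  · rcases dist_left_le_or_dist_right_le_of_notMem_segment hp hps hx with hle | hle
    · exact .inl (dist_le_dist_of_dist_orthogonalProjection_le c hxs ha hle)
    · exact .inr (.inl (dist_le_dist_of_dist_orthogonalProjection_le c hxs hb hle))

end


/-- The distance from a point `c` to a polygonal boundary, i.e. a finite union
of closed segments, equals the minimum of the distances from `c` to the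
finite set consisting of all segment endpoints (vertices) together with all
active foot points (perpendicular feet lying on their segments). -/
theorem infDist_polygonal_boundary_eq_min_vertices_and_active_feet
    (ι : Type*) [Fintype ι] [Nonempty ι]
    (a b : ι → EuclideanSpace ℝ (Fin 2)) (hab : ∀ e, a e ≠ b e)
    (c : EuclideanSpace ℝ (Fin 2))
    (h : ι → EuclideanSpace ℝ (Fin 2))
    (hproj : ∀ e,
      h e = (EuclideanGeometry.orthogonalProjection (affineSpan ℝ {a e, b e}) c :
        EuclideanSpace ℝ (Fin 2)))
    (V : Finset (EuclideanSpace ℝ (Fin 2)))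
    (hV : ∀ v, v ∈ V ↔
      (∃ e, v = a e) ∨ (∃ e, v = b e) ∨
        ∃ e, h e ∈ segment ℝ (a e) (b e) ∧ v = h e)
    (hVne : V.Nonempty) :
    Metric.infDist c (⋃ e, segment ℝ (a e) (b e)) =
      V.inf' hVne (fun v => dist c v) := by
  refine le_antisymm (Finset.le_inf' _ _ fun v hv => Metric.infDist_le_dist_of_mem ?_) ?_
  · rw [Set.mem_iUnion]
    rcases (hV v).1 hv with ⟨e, rfl⟩ | ⟨e, rfl⟩ | ⟨e, he, rfl⟩
    · exact ⟨e, left_mem_segment ℝ _ _⟩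
    · exact ⟨e, right_mem_segment ℝ _ _⟩
    · exact ⟨e, he⟩
  · obtain ⟨e₀⟩ := ‹Nonempty ι›
    refine (Metric.le_infDist ⟨a e₀, Set.mem_iUnion.2 ⟨e₀, left_mem_segment ℝ _ _⟩⟩).2
      fun x hx => ?_
    obtain ⟨e, hxe⟩ := Set.mem_iUnion.1 hx
    rcases dist_vertex_or_active_foot_le c hxe with hle | hle | ⟨hmem, hle⟩
    · exact (Finset.inf'_le _ ((hV _).2 (.inl ⟨e, rfl⟩))).trans hle
    · exact (Finset.inf'_le _ ((hV _).2 (.inr (.inl ⟨e, rfl⟩)))).trans hle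
    · rw [← hproj e] at hmem hle
      exact (Finset.inf'_le _ ((hV _).2 (.inr (.inr ⟨e, hmem, rfl⟩)))).trans hle
end

section
/- Let C be a closed convex subset of the Euclidean plane, let r ≥ 0, and let c be a point. Then Metric.closedBall c r ⊆ C + Metric.closedBall 0 r (Minkowski sum of sets) if and only if c ∈ C. (This cancellation property is the key to converting between the point arrangement problem in a convex region C and the circle packing problem in the enlarged region C + closedBall 0 r.) -/
open scoped Pointwise

/-- For a closed convex region `C` in the Euclidean plane and `r ≥ 0`, the
closed ball of radius `r` around `c` is contained in the Minkowski sum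
`C + closedBall 0 r` if and only if `c ∈ C`. -/
theorem closedBall_subset_add_closedBall_iff_mem
    (C : Set (EuclideanSpace ℝ (Fin 2))) (hC : IsClosed C) (hconv : Convex ℝ C)
    (r : ℝ) (hr : 0 ≤ r) (c : EuclideanSpace ℝ (Fin 2)) :
    Metric.closedBall c r ⊆ C + Metric.closedBall 0 r ↔ c ∈ C := by
  constructor
  · intro h
    by_contra hc
    obtain ⟨f, u, hfC, hfc⟩ := geometric_hahn_banach_closed_point hconv hC hc
    obtain ⟨b₀, hb₀, hmax⟩ :=
      (isCompact_closedBall (0 : EuclideanSpace ℝ (Fin 2)) r).exists_isMaxOn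
        (Metric.nonempty_closedBall.2 hr) f.continuous.continuousOn
    have hmem : c + b₀ ∈ Metric.closedBall c r := by
      simpa [mem_closedBall_iff_norm] using hb₀
    obtain ⟨a, ha, b, hb, hab⟩ := Set.mem_add.1 (h hmem)
    have hfab : f a + f b = f c + f b₀ := by rw [← map_add, hab, map_add]
    have hfb : f b ≤ f b₀ := hmax hb
    linarith [hfC a ha]
  · intro hc x hx
    refine Set.mem_add.2 ⟨c, hc, x - c, ?_, add_sub_cancel c x⟩
    simpa [dist_eq_norm] using hx
end

section
/- Let C be a closed convex subset of the Euclidean plane, let D > 0, and let c : Fin p → EuclideanSpace ℝ (Fin 2) be p points. Then the following are equivalent: (i) every c i ∈ C and dist (c i) (c j) ≥ D for all i ≠ j; (ii) every closed ball Metric.closedBall (c i) (D/2) is contained in the Minkowski sum C + Metric.closedBall 0 (D/2), and the open balls Metric.ball (c i) (D/2) and Metric.ball (c j) (D/2) are disjoint for all i ≠ j. -/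
open scoped Pointwise

/-- A point of a Hilbert space lies in a closed convex set `C` as soon as the closed ball of
radius `r` around it lies in the closed `r`-thickening of `C`. -/
theorem mem_of_closedBall_subset_add_closedBall {E : Type*} [NormedAddCommGroup E]
    [InnerProductSpace ℝ E] [CompleteSpace E] {C : Set E} (hC : IsClosed C)
    (hconv : Convex ℝ C) {x : E} {r : ℝ} (hr : 0 ≤ r)
    (h : Metric.closedBall x r ⊆ C + Metric.closedBall 0 r) : x ∈ C := by
  obtain ⟨w₀, hw₀, -⟩ := Set.mem_add.1 (h (Metric.mem_closedBall_self hr))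
  obtain ⟨v, hv, hmin⟩ :=
    exists_norm_eq_iInf_of_complete_convex ⟨w₀, hw₀⟩ hC.isComplete hconv x
  rw [norm_eq_iInf_iff_real_inner_le_zero hconv hv] at hmin
  by_contra hx
  have hd : 0 < ‖x - v‖ := norm_pos_iff.2 (sub_ne_zero.2 fun e => hx (e ▸ hv))
  have hy : x + (r / ‖x - v‖) • (x - v) ∈ Metric.closedBall x r := by
    rw [mem_closedBall_iff_norm, add_sub_cancel_left, norm_smul, norm_div, norm_norm,
      div_mul_cancel₀ _ hd.ne', Real.norm_of_nonneg hr]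
  obtain ⟨w, hw, b, hb, hwb⟩ := Set.mem_add.1 (h hy)
  rw [mem_closedBall_zero_iff] at hb
  have hinner : ‖x - v‖ ^ 2 + r * ‖x - v‖ =
      inner ℝ (x - v) (w - v) + inner ℝ (x - v) b := by
    have hsum : w - v + b = (x - v) + (r / ‖x - v‖) • (x - v) := by
      rw [sub_add_eq_add_sub, hwb, add_sub_right_comm]
    rw [← inner_add_right, hsum, inner_add_right, real_inner_smul_right,
      real_inner_self_eq_norm_sq]
    field_simp
  have hcs : inner ℝ (x - v) b ≤ ‖x - v‖ * r :=
    (real_inner_le_norm _ _).trans (by gcongr)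
  nlinarith [hmin w hw]

/-- For a closed convex region `C`, placing `p` points in `C` at pairwise
distances at least `D` is equivalent to packing `p` non-overlapping open disks
of radius `D/2`, with closures contained in the enlarged convex region
`C + closedBall 0 (D/2)`. -/
theorem point_arrangement_iff_packing_in_enlarged_region
    (C : Set (EuclideanSpace ℝ (Fin 2))) (hC : IsClosed C) (hconv : Convex ℝ C)
    (D : ℝ) (hD : 0 < D) (p : ℕ) (c : Fin p → EuclideanSpace ℝ (Fin 2)) :
    ((∀ i, c i ∈ C) ∧ ∀ i j, i ≠ j → D ≤ dist (c i) (c j)) ↔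
      ((∀ i, Metric.closedBall (c i) (D / 2) ⊆
          C + Metric.closedBall 0 (D / 2)) ∧
        ∀ i j, i ≠ j →
          Disjoint (Metric.ball (c i) (D / 2)) (Metric.ball (c j) (D / 2))) := by
  have hD2 : 0 < D / 2 := half_pos hD
  refine and_congr (forall_congr' fun i => ⟨fun hi => ?_, fun hi =>
    mem_of_closedBall_subset_add_closedBall hC hconv hD2.le hi⟩)
    (forall₃_congr fun i j _ => by rw [disjoint_ball_ball_iff hD2 hD2, add_halves])
  rw [← add_zero (c i), ← singleton_add_closedBall]
  exact Set.add_subset_add_right (Set.singleton_subset_iff.2 hi)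
end
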